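/- arXiv:2410.18488 — 7 statements merged into one kernel-verified Lean document; each statement's English description precedes it below -/
import Mathlib

section
/- Kac's lemma: Let (X, B, μ) be a probability space, let T : X → X be an ergodic measure-preserving transformation, and let A ∈ B with μ(A) > 0. Define the first return time r_A(x) = min { n ≥ 1 : T^n(x) ∈ A } for x ∈ A. Then ∫_A r_A(x) dμ(x) = 1. -/
open MeasureTheory

open Filter Topology

/-- The points whose orbit under `T` does not meet `A` at any time `k < n`. -/
def avoidingSet {X : Type*} (T : X → X) (A : Set X) (n : ℕ) : Set X :=
  {x | ∀ k < n, T^[k] x ∉ A}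

section avoidingSet

variable {X : Type*} {T : X → X} {A : Set X}

@[simp]
lemma avoidingSet_zero : avoidingSet T A 0 = Set.univ := by
  simp [avoidingSet]

lemma antitone_avoidingSet : Antitone (avoidingSet T A) :=
  fun _ _ hmn _ hx k hk ↦ hx k (hk.trans_le hmn)

lemma avoidingSet_succ (n : ℕ) :
    avoidingSet T A (n + 1) = T ⁻¹' avoidingSet T A n \ A := by
  ext x
  simp only [avoidingSet, Set.mem_sdiff, Set.mem_preimage, Set.mem_ofPred_eq,
    ← Function.iterate_succ_apply]
  refine ⟨fun h ↦ ⟨fun k hk ↦ h (k + 1) (by omega), h 0 (by omega)⟩, ?_⟩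
  rintro ⟨h, h0⟩ (_ | k) hk
  · exact h0
  · exact h k (by omega)

lemma mem_preimage_avoidingSet_iff {x : X} (hx : ∃ k, T^[k] (T x) ∈ A) (n : ℕ) :
    x ∈ T ⁻¹' avoidingSet T A n ↔ n < sInf {n : ℕ | 1 ≤ n ∧ T^[n] x ∈ A} := by
  obtain ⟨k, hk⟩ := hx
  have hne : {n : ℕ | 1 ≤ n ∧ T^[n] x ∈ A}.Nonempty := ⟨k + 1, by omega, hk⟩
  constructor
  · intro h
    by_contra! hle
    obtain ⟨h1, hmem⟩ := Nat.sInf_mem hne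
    obtain ⟨m, hm⟩ := Nat.exists_eq_add_of_le' h1
    rw [hm] at hmem hle
    exact h m (by omega) hmem
  · intro h m hm hmem
    have hle : sInf {n : ℕ | 1 ≤ n ∧ T^[n] x ∈ A} ≤ m + 1 := Nat.sInf_le ⟨by omega, hmem⟩
    omega

variable [MeasurableSpace X] {μ : Measure X}

lemma measurableSet_avoidingSet (hT : Measurable T) (hA : MeasurableSet A) (n : ℕ) :
    MeasurableSet (avoidingSet T A n) := by
  induction n with
  | zero => simp
  | succ n ih => rw [avoidingSet_succ]; exact (hT ih).diff hA

lemma sum_measure_add_measure_avoidingSet (hT : MeasurePreserving T μ μ) (hA : MeasurableSet A)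
    (N : ℕ) :
    ∑ n ∈ Finset.range N, μ (T ⁻¹' avoidingSet T A n ∩ A) + μ (avoidingSet T A N) =
      μ Set.univ := by
  induction N with
  | zero => simp
  | succ N ih =>
    rw [Finset.sum_range_succ, avoidingSet_succ, add_assoc, measure_inter_add_sdiff _ hA,
      hT.measure_preimage (measurableSet_avoidingSet hT.measurable hA N).nullMeasurableSet, ih]

/-- Almost every orbit of an ergodic transformation visits a given set of positive measure. -/
lemma Ergodic.ae_exists_iterate_mem [IsFiniteMeasure μ] (hT : Ergodic T μ)
    (hA : MeasurableSet A) (hApos : 0 < μ A) : ∀ᵐ x ∂μ, ∃ k, T^[k] x ∈ A := by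
  have hG : MeasurableSet (⋃ k, T^[k] ⁻¹' A) :=
    MeasurableSet.iUnion fun k ↦ hT.measurable.iterate k hA
  have hsub : T ⁻¹' (⋃ k, T^[k] ⁻¹' A) ⊆ ⋃ k, T^[k] ⁻¹' A := by
    intro x hx
    obtain ⟨k, hk⟩ := Set.mem_iUnion.1 hx
    exact Set.mem_iUnion.2 ⟨k + 1, hk⟩
  rcases hT.ae_empty_or_univ_of_preimage_ae_le hG.nullMeasurableSet hsub.eventuallyLE with h | h
  · have hle : μ A ≤ μ (⋃ k, T^[k] ⁻¹' A) := measure_mono (Set.subset_iUnion_of_subset 0 le_rfl)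
    rw [measure_congr h, measure_empty] at hle
    exact absurd hle hApos.not_ge
  · filter_upwards [eventuallyEq_univ.1 h] with x hx
    simpa using hx

lemma tendsto_measure_avoidingSet [IsFiniteMeasure μ] (hT : Ergodic T μ)
    (hA : MeasurableSet A) (hApos : 0 < μ A) :
    Tendsto (fun n ↦ μ (avoidingSet T A n)) atTop (𝓝 0) := by
  have hzero : μ (⋂ n, avoidingSet T A n) = 0 := by
    refine measure_mono_null ?_ (ae_iff.1 (hT.ae_exists_iterate_mem hA hApos))
    rintro x hx ⟨k, hk⟩
    exact Set.mem_iInter.1 hx (k + 1) k k.lt_succ_self hk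
  rw [← hzero]
  exact tendsto_measure_iInter_atTop
    (fun n ↦ (measurableSet_avoidingSet hT.measurable hA n).nullMeasurableSet)
    antitone_avoidingSet ⟨0, measure_ne_top _ _⟩

end avoidingSet

lemma ENNReal.tsum_ite_lt (m : ℕ) : ∑' n : ℕ, (if n < m then 1 else 0 : ENNReal) = m := by
  rw [tsum_eq_sum (s := Finset.range m) (by simp), Finset.sum_ite_of_true (by simp)]
  simp

/-- **Kac's lemma.** If `T` is an ergodic measure-preserving transformation of a probability
space `(X, μ)` and `A` is a measurable set of positive measure, then the integral over `A` of
the first return time `r_A x = min {n ≥ 1 : T^[n] x ∈ A}` equals `1`. -/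
theorem kac_lemma {X : Type*} [MeasurableSpace X] (μ : Measure X) [IsProbabilityMeasure μ]
    (T : X → X) (hT : Ergodic T μ) (A : Set X) (hA : MeasurableSet A) (hApos : 0 < μ A) :
    ∫⁻ x in A, ((sInf {n : ℕ | 1 ≤ n ∧ T^[n] x ∈ A} : ℕ) : ENNReal) ∂μ = 1 := by
  have hmeas (n : ℕ) : MeasurableSet (T ⁻¹' avoidingSet T A n) :=
    hT.measurable (measurableSet_avoidingSet hT.measurable hA n)
  have hreturn : ∀ᵐ x ∂μ, ∃ k, T^[k] (T x) ∈ A :=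
    hT.quasiMeasurePreserving.ae (hT.ae_exists_iterate_mem hA hApos)
  have hlayer : ∀ᵐ x ∂μ.restrict A, ((sInf {n : ℕ | 1 ≤ n ∧ T^[n] x ∈ A} : ℕ) : ENNReal) =
      ∑' n, (T ⁻¹' avoidingSet T A n).indicator 1 x := by
    classical
    filter_upwards [ae_restrict_of_ae hreturn] with x hx
    rw [← ENNReal.tsum_ite_lt]
    refine tsum_congr fun n ↦ ?_
    simp only [Set.indicator_apply, mem_preimage_avoidingSet_iff hx, Pi.one_apply]
  rw [lintegral_congr_ae hlayer,
    lintegral_tsum fun n ↦ (measurable_one.indicator (hmeas n)).aemeasurable]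
  simp_rw [lintegral_indicator_one (hmeas _), Measure.restrict_apply (hmeas _)]
  have hlim := (ENNReal.tendsto_nat_tsum fun n ↦ μ (T ⁻¹' avoidingSet T A n ∩ A)).add
    (tendsto_measure_avoidingSet hT hA hApos)
  simp_rw [sum_measure_add_measure_avoidingSet hT.toMeasurePreserving hA, measure_univ,
    add_zero] at hlim
  exact tendsto_nhds_unique hlim tendsto_const_nhds
end

section
/- Let Γ be a countable group, let (X, B, μ, T) be a probability-preserving Γ-action, let A ∈ B with μ(A) > 0, and let κ : X → Γ be an A-allocation. Define T_κ : X → X by T_κ(x) = T_{κ(x)}(x). For any B-measurable function f : X → [0, +∞], define f_κ : A → [0, +∞] by f_κ(x) = Σ_{y ∈ X : T_κ(y) = x} f(y). Then ∫_A f_κ(x) dμ(x) = ∫_X f(x) dμ(x). -/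
open MeasureTheory

/-- For a group action, the sum of `f` over the fiber of `y ↦ T (κ y) y` above `x` can be
reindexed by the group. -/
theorem tsum_fiber_allocation_eq {Γ X : Type*} [Group Γ]
    (T : Γ → X → X) (hT1 : T 1 = id) (hTmul : ∀ γ δ : Γ, T γ ∘ T δ = T (γ * δ))
    (κ : X → Γ) (f : X → ENNReal) (x : X) :
    ∑' y : {y : X // T (κ y) y = x}, f (y : X) =
      ∑' γ : Γ, {y | κ y = γ}.indicator f (T γ⁻¹ x) := by
  have hinv (γ : Γ) (y : X) : T γ⁻¹ (T γ y) = y := by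
    simpa [hT1] using congrFun (hTmul γ⁻¹ γ) y
  have hinv' (γ : Γ) (y : X) : T γ (T γ⁻¹ y) = y := by
    simpa [hT1] using congrFun (hTmul γ γ⁻¹) y
  let e : {y : X // T (κ y) y = x} ≃ {γ : Γ | κ (T γ⁻¹ x) = γ} :=
    { toFun := fun y => ⟨κ y, by
        obtain ⟨y, rfl⟩ := y
        simp [hinv]⟩
      invFun := fun γ => ⟨T (γ : Γ)⁻¹ x, by
        rw [show κ (T (γ : Γ)⁻¹ x) = γ from γ.2, hinv']⟩
      left_inv := by
        rintro ⟨y, rfl⟩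
        simp [hinv]
      right_inv := fun γ => Subtype.ext γ.2 }
  have hsum := e.symm.tsum_eq fun y : {y : X // T (κ y) y = x} => f (y : X)
  rw [← hsum]
  exact tsum_subtype {γ : Γ | κ (T γ⁻¹ x) = γ} fun γ => f (T γ⁻¹ x)

/-- **Generalized Kac lemma for allocations.** Let `(X, μ, T)` be a probability-preserving
action of a countable group `Γ`, `A` a measurable set of positive measure, and `κ : X → Γ`
an `A`-allocation (i.e. `T (κ x) x ∈ A` almost surely). Then for any measurable
`f : X → [0,∞]`, the function `f_κ (x) = ∑_{y : T (κ y) y = x} f y` satisfies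
`∫_A f_κ dμ = ∫_X f dμ`. -/
theorem kac_lemma_allocation {Γ X : Type*} [Group Γ] [Countable Γ]
    [MeasurableSpace X] (μ : Measure X) [IsProbabilityMeasure μ]
    (T : Γ → X → X) (hT1 : T 1 = id) (hTmul : ∀ γ δ : Γ, T γ ∘ T δ = T (γ * δ))
    (hTmp : ∀ γ : Γ, MeasurePreserving (T γ) μ μ)
    (A : Set X) (hA : MeasurableSet A) (hApos : 0 < μ A)
    (κ : X → Γ) (hκmeas : ∀ γ : Γ, MeasurableSet {x | κ x = γ})
    (hκalloc : ∀ᵐ x ∂μ, T (κ x) x ∈ A)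
    (f : X → ENNReal) (hf : Measurable f) :
    ∫⁻ x in A, (∑' y : {y : X // T (κ y) y = x}, f (y : X)) ∂μ = ∫⁻ x, f x ∂μ := by
  have hinv (γ : Γ) (y : X) : T γ (T γ⁻¹ y) = y := by
    simpa [hT1] using congrFun (hTmul γ γ⁻¹) y
  have hmeas (γ : Γ) : Measurable ({y | κ y = γ}.indicator f) := hf.indicator (hκmeas γ)
  have hterm (γ : Γ) : ∫⁻ x in A, {y | κ y = γ}.indicator f (T γ⁻¹ x) ∂μ =
      ∫⁻ y, {y | κ y = γ}.indicator f y ∂μ := by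
    have hpre : MeasurableSet (T γ ⁻¹' A) := (hTmp γ).measurable hA
    have hchange := (hTmp γ⁻¹).setLIntegral_comp_preimage hpre (hmeas γ)
    have hset : T γ⁻¹ ⁻¹' (T γ ⁻¹' A) = A := by
      ext x
      simp [hinv]
    rw [hset] at hchange
    rw [hchange, ← lintegral_indicator hpre]
    refine lintegral_congr_ae ?_
    filter_upwards [hκalloc] with y hy
    by_cases hyκ : κ y = γ
    · subst hyκ
      exact Set.indicator_of_mem (s := T (κ y) ⁻¹' A) hy _
    · simp [hyκ]
  calc
    _ = ∫⁻ x in A, ∑' γ : Γ, {y | κ y = γ}.indicator f (T γ⁻¹ x) ∂μ :=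
      lintegral_congr fun x => tsum_fiber_allocation_eq T hT1 hTmul κ f x
    _ = ∑' γ : Γ, ∫⁻ y, {y | κ y = γ}.indicator f y ∂μ := by
      refine (lintegral_tsum fun γ => ?_).trans (tsum_congr hterm)
      exact ((hmeas γ).comp (hTmp γ⁻¹).measurable).aemeasurable
    _ = ∫⁻ y, f y ∂μ := by
      rw [← lintegral_tsum fun γ => (hmeas γ).aemeasurable]
      refine lintegral_congr fun y => ?_
      rw [tsum_eq_single (κ y) fun γ hγ => by simp [hγ.symm]]
      simp
end

section
/- Let Γ be a countable group. Then there exists a sequence of finite subsets B_1, B_2, … of Γ with 1_Γ ∈ B_n for all n, such that for any probability-preserving Γ-action (X, B, μ, T) and any sweep-out set A ∈ B there exists a measurable function φ : A → ℕ such that: (i) up to a μ-null set, X is the disjoint union over n ∈ ℕ and γ ∈ B_n of the sets T_γ⁻¹(φ⁻¹({n})), and (ii) ∫_A |B_{φ(x)}| dμ(x) = 1. -/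
open MeasureTheory

/-- A countable conjunction of measurable conditions is a measurable condition. -/
theorem measurableSet_forall_of_countable {ι : Sort*} {X : Type*} [Countable ι]
    [MeasurableSpace X] {p : ι → X → Prop} (hp : ∀ i, MeasurableSet {x | p i x}) :
    MeasurableSet {x | ∀ i, p i x} := by
  rw [Set.ofPred_forall]
  exact MeasurableSet.iInter hp

/-- A countable group has an injective ranking by natural numbers under which the identity comes
first. -/
theorem exists_injective_nat_one_eq_zero (Γ : Type*) [Group Γ] [Countable Γ] :
    ∃ e : Γ → ℕ, Function.Injective e ∧ e 1 = 0 := by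
  classical
  obtain ⟨f, hf⟩ := exists_injective_nat Γ
  refine ⟨fun γ => if γ = 1 then 0 else f γ + 1, fun a b hab => ?_, by simp⟩
  by_cases ha : a = 1 <;> by_cases hb : b = 1 <;> simp [ha, hb] at hab ⊢
  exact hf hab

/-- The finite subsets of a countable group that contain the identity can be enumerated. -/
theorem exists_enumeration_finset_one_mem (Γ : Type*) [Group Γ] [Countable Γ] :
    ∃ B : ℕ → Finset Γ, (∀ n, (1 : Γ) ∈ B n) ∧ ∀ s : Finset Γ, 1 ∈ s → ∃ n, B n = s := by
  have : Nonempty {s : Finset Γ // 1 ∈ s} := ⟨⟨{1}, by simp⟩⟩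
  obtain ⟨f, hf⟩ := exists_surjective_nat {s : Finset Γ // 1 ∈ s}
  refine ⟨fun n => f n, fun n => (f n).2, fun s hs => ?_⟩
  obtain ⟨n, hn⟩ := hf ⟨s, hs⟩
  exact ⟨n, by simp [hn]⟩

/-- A measurable choice of an index `φ x` with `B (φ x) = {γ | x ∈ E γ}` whenever such an index
exists, and `B (φ x) = s` otherwise. -/
theorem exists_measurable_index {Γ X : Type*} [Countable Γ] [MeasurableSpace X]
    (B : ℕ → Finset Γ) {E : Γ → Set X} (hE : ∀ γ, MeasurableSet (E γ)) {s : Finset Γ}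
    (hs : ∃ n, B n = s) :
    ∃ φ : X → ℕ, Measurable φ ∧ ∀ x, (B (φ x) : Set Γ) = {γ | x ∈ E γ} ∨
      ((∀ m, (B m : Set Γ) ≠ {γ | x ∈ E γ}) ∧ B (φ x) = s) := by
  classical
  have hm : ∀ n, MeasurableSet {x | (B n : Set Γ) = {γ | x ∈ E γ}} := by
    intro n
    simp only [Set.ext_iff, Set.mem_ofPred_eq]
    exact measurableSet_forall_of_countable fun γ => (MeasurableSet.const _).iff (hE γ)
  have hex : ∀ x, ∃ n, (B n : Set Γ) = {γ | x ∈ E γ} ∨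
      ((∀ m, (B m : Set Γ) ≠ {γ | x ∈ E γ}) ∧ B n = s) := by
    intro x
    by_cases h : ∃ n, (B n : Set Γ) = {γ | x ∈ E γ}
    · exact h.imp fun n hn => Or.inl hn
    · exact hs.imp fun n hn => Or.inr ⟨not_exists.mp h, hn⟩
  refine ⟨fun x => Nat.find (hex x), measurable_find hex fun n => ?_,
    fun x => Nat.find_spec (hex x)⟩
  exact (hm n).union ((measurableSet_forall_of_countable fun m => (hm m).compl).inter
    (MeasurableSet.const _))

/-- **Generalized Kac lemma for countable groups.** For every countable group `Γ` there is a
sequence of finite subsets `B n ⊆ Γ`, each containing the identity, such that for every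
probability-preserving `Γ`-action `(X, μ, T)` and every sweep-out set `A` there is a
measurable `φ : A → ℕ` such that the sets `T γ ⁻¹' (A ∩ φ⁻¹ {n})`, for `n ∈ ℕ` and
`γ ∈ B n`, are pairwise disjoint, their union has full measure, and
`∫_A |B (φ x)| dμ = 1`. -/
theorem kac_function_group_action {Γ : Type*} [Group Γ] [Countable Γ] :
    ∃ B : ℕ → Finset Γ, (∀ n, (1 : Γ) ∈ B n) ∧
      ∀ (X : Type*) [MeasurableSpace X] (μ : Measure X) [IsProbabilityMeasure μ]
        (T : Γ → X → X), T 1 = id → (∀ γ δ : Γ, T γ ∘ T δ = T (γ * δ)) →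
        (∀ γ : Γ, MeasurePreserving (T γ) μ μ) →
        ∀ A : Set X, MeasurableSet A → μ (⋃ γ : Γ, T γ ⁻¹' A) = 1 →
        ∃ φ : X → ℕ, Measurable φ ∧
          (∀ (n m : ℕ) (γ γ' : Γ), γ ∈ B n → γ' ∈ B m → (n, γ) ≠ (m, γ') →
            Disjoint (T γ ⁻¹' (A ∩ φ ⁻¹' {n})) (T γ' ⁻¹' (A ∩ φ ⁻¹' {m}))) ∧
          μ (⋃ n : ℕ, ⋃ γ ∈ B n, T γ ⁻¹' (A ∩ φ ⁻¹' {n})) = 1 ∧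
          ∫⁻ x in A, ((B (φ x)).card : ENNReal) ∂μ = 1 := by
  classical
  obtain ⟨e, he, he1⟩ := exists_injective_nat_one_eq_zero Γ
  obtain ⟨B, hB1, hB⟩ := exists_enumeration_finset_one_mem Γ
  refine ⟨B, hB1, fun X _ μ _ T hT1 hTmul hT A hA hsweep => ?_⟩
  have hTinv : ∀ γ x, T γ⁻¹ (T γ x) = x := fun γ x => by
    simpa [hT1] using congrFun (hTmul γ⁻¹ γ) x
  have hTA : ∀ γ, MeasurableSet (T γ ⁻¹' A) := fun γ => (hT γ).measurable hA
  -- `D γ` is the set of points whose first visit to `A` is through `γ`.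
  set D : Γ → Set X := fun γ => {x | T γ x ∈ A ∧ ∀ δ, e δ < e γ → T δ x ∉ A} with hD
  have hDm : ∀ γ, MeasurableSet (D γ) := fun γ =>
    (hTA γ).inter (measurableSet_forall_of_countable fun δ =>
      measurableSet_forall_of_countable fun _ => (hTA δ).compl)
  have hDuniq : ∀ {γ δ x}, x ∈ D γ → x ∈ D δ → γ = δ := by
    intro γ δ x hγ hδ
    refine he (le_antisymm ?_ ?_)
    · exact not_lt.mp fun h => hγ.2 δ h hδ.1
    · exact not_lt.mp fun h => hδ.2 γ h hγ.1
  have hDdisj : Pairwise (Function.onFun Disjoint D) := fun γ δ hne =>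
    Set.disjoint_left.mpr fun x hγ hδ => hne (hDuniq hγ hδ)
  have hDcover : ∀ x ∈ ⋃ γ, T γ ⁻¹' A, ∃ γ, x ∈ D γ := by
    intro x hx
    obtain ⟨γ, hγ⟩ := Set.mem_iUnion.mp hx
    obtain ⟨γ, hγ, hmin⟩ := (measure e).wf.has_min {γ | T γ x ∈ A} ⟨γ, hγ⟩
    exact ⟨γ, hγ, fun δ hlt hδ => hmin δ hδ hlt⟩
  have hD1 : ∀ x ∈ A, x ∈ D 1 := fun x hx => ⟨by simpa [hT1] using hx, by simp [he1]⟩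
  set E : Γ → Set X := fun γ => T γ⁻¹ ⁻¹' D γ with hE
  have hEm : ∀ γ, MeasurableSet (E γ) := fun γ => (hT γ⁻¹).measurable (hDm γ)
  have hE1 : ∀ x ∈ A, x ∈ E 1 := fun x hx => by simpa [hE, hT1] using hD1 x hx
  have hEA : ∀ {γ x}, x ∈ E γ → x ∈ A := by
    intro γ x hx
    have h := hTinv γ⁻¹ x
    rw [inv_inv] at h
    simpa only [h] using hx.1
  have hED : ∀ {γ x}, T γ x ∈ E γ ↔ x ∈ D γ := by
    intro γ x
    simp only [hE, Set.mem_preimage, hTinv]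
  have hEfin : ∀ᵐ x ∂μ, {γ | x ∈ E γ}.Finite := by
    refine ae_finite_setOfPred_mem ?_
    simp only [hE, (hT _).measure_preimage (hDm _).nullMeasurableSet]
    rw [← measure_iUnion hDdisj hDm]
    exact measure_ne_top _ _
  obtain ⟨φ, hφ, hφE⟩ := exists_measurable_index B hEm (hB {1} (by simp))
  have hBE : ∀ {x γ}, x ∈ A → γ ∈ B (φ x) → x ∈ E γ := by
    intro x γ hx hγ
    rcases hφE x with h | ⟨-, h⟩
    · have : γ ∈ (B (φ x) : Set Γ) := hγ
      rwa [h] at this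
    · rw [h, Finset.mem_singleton] at hγ
      exact hγ ▸ hE1 x hx
  have hEB : ∀ {x γ}, {γ | x ∈ E γ}.Finite → x ∈ E γ → γ ∈ B (φ x) := by
    intro x γ hfin hγ
    rcases hφE x with h | ⟨h, -⟩
    · rw [← Finset.mem_coe, h]
      exact hγ
    · obtain ⟨n, hn⟩ := hB hfin.toFinset (by simpa using hE1 x (hEA hγ))
      exact absurd (by simp [hn]) (h n)
  have hdisj : ∀ (n m : ℕ) (γ γ' : Γ), γ ∈ B n → γ' ∈ B m → (n, γ) ≠ (m, γ') →
      Disjoint (T γ ⁻¹' (A ∩ φ ⁻¹' {n})) (T γ' ⁻¹' (A ∩ φ ⁻¹' {m})) := by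
    intro n m γ γ' hγ hγ' hne
    refine Set.disjoint_left.mpr ?_
    rintro x ⟨hxA, rfl⟩ ⟨hxA', rfl⟩
    obtain rfl := hDuniq (hED.mp (hBE hxA hγ)) (hED.mp (hBE hxA' hγ'))
    exact hne rfl
  have hcell : ∀ n, MeasurableSet (A ∩ φ ⁻¹' {n}) := fun n =>
    hA.inter (hφ (measurableSet_singleton n))
  have hfull : μ (⋃ n : ℕ, ⋃ γ ∈ B n, T γ ⁻¹' (A ∩ φ ⁻¹' {n})) = 1 := by
    have hmeas : MeasurableSet (⋃ γ, T γ ⁻¹' A) := MeasurableSet.iUnion hTA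
    have hae : ∀ᵐ x ∂μ, x ∈ ⋃ γ, T γ ⁻¹' A := (mem_ae_iff_prob_eq_one hmeas).mpr hsweep
    refine (mem_ae_iff_prob_eq_one ?_).mp ?_
    · exact MeasurableSet.iUnion fun n => Finset.measurableSet_biUnion _ fun γ _ =>
        (hT γ).measurable (hcell n)
    have hfin : ∀ᵐ x ∂μ, ∀ γ, {δ | T γ x ∈ E δ}.Finite :=
      ae_all_iff.mpr fun γ => (hT γ).quasiMeasurePreserving.ae hEfin
    filter_upwards [hae, hfin] with x hx hxfin
    obtain ⟨γ, hγ⟩ := hDcover x hx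
    simp only [Set.mem_iUnion]
    exact ⟨φ (T γ x), γ, hEB (hxfin γ) (hED.mpr hγ), hγ.1, rfl⟩
  refine ⟨φ, hφ, hdisj, hfull, ?_⟩
  have hcard : Measurable fun n : ℕ => ((B n).card : ENNReal) := measurable_of_countable _
  rw [← hfull, ← lintegral_map hcard hφ, lintegral_countable', measure_iUnion]
  · refine tsum_congr fun n => ?_
    rw [Measure.map_apply hφ (measurableSet_singleton n),
      Measure.restrict_apply (hφ (measurableSet_singleton n)), Set.inter_comm,
      measure_biUnion_finset]
    · simp only [(hT _).measure_preimage (hcell n).nullMeasurableSet, Finset.sum_const,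
        nsmul_eq_mul]
    · exact fun γ hγ δ hδ hne => hdisj n n γ δ hγ hδ (by simpa using hne)
    · exact fun γ _ => (hT γ).measurable (hcell n)
  · intro n m hnm
    simp only [Function.onFun, Set.disjoint_iUnion_left, Set.disjoint_iUnion_right]
    exact fun γ hγ δ hδ => hdisj _ _ _ _ ‹_› ‹_› (by simp [hnm])
  · exact fun n => Finset.measurableSet_biUnion _ fun γ _ => (hT γ).measurable (hcell n)
end

section
/- For Γ = ℤ^d the universal shape sequence in the generalized Kac theorem can be taken almost convex: there exists a sequence B_1, B_2, … of finite almost convex subsets of ℤ^d, each containing 0, such that for any probability-preserving ℤ^d-action (X, B, μ, T) and any sweep-out set A ∈ B there exists a measurable function φ : A → ℕ such that, up to a μ-null set, X is the disjoint union over n ∈ ℕ and v ∈ B_n of the sets T_v⁻¹(φ⁻¹({n})), and ∫_A |B_{φ(x)}| dμ(x) = 1. -/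
open MeasureTheory

/-- A subset `B ⊆ ℤ^d` is *almost convex* if it contains every integer point lying in the
interior of its convex hull in `ℝ^d`. -/
def AlmostConvex {d : ℕ} (B : Set (Fin d → ℤ)) : Prop :=
  ∀ v : Fin d → ℤ,
    (fun i => (v i : ℝ)) ∈
      interior (convexHull ℝ ((fun (w : Fin d → ℤ) (i : Fin d) => (w i : ℝ)) '' B)) →
    v ∈ B

namespace KacVoronoi

variable {d : ℕ}

/-- Squared Euclidean norm with an injective tie-break; its minimizer selects a nearest point. -/
noncomputable def key (v : Fin d → ℤ) : ℕ ×ₗ ℕ :=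
  toLex (∑ i, (v i).natAbs ^ 2, Encodable.encode v)

lemma key_injective : Function.Injective (key (d := d)) := by
  intro v w h
  have h' := congrArg (fun p => (ofLex p).2) h
  exact Encodable.encode_injective h'

lemma key_le_of_sum_lt {v w : Fin d → ℤ} (h : ∑ i, v i ^ 2 < ∑ i, w i ^ 2) :
    key v ≤ key w := by
  refine Prod.Lex.toLex_le_toLex.2 (Or.inl ?_)
  zify
  simpa using h

lemma sum_le_of_key_le {v w : Fin d → ℤ} (h : key v ≤ key w) :
    ∑ i, v i ^ 2 ≤ ∑ i, w i ^ 2 := by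
  have h' : ∑ i, (v i).natAbs ^ 2 ≤ ∑ i, (w i).natAbs ^ 2 := by
    rcases Prod.Lex.toLex_le_toLex.1 h with h | h
    · exact h.le
    · exact h.1.le
  zify at h'
  simpa using h'

lemma sum_sq_pos {u : Fin d → ℤ} (hu : u ≠ 0) : 0 < ∑ i, u i ^ 2 := by
  obtain ⟨i, hi⟩ := Function.ne_iff.1 hu
  exact Finset.sum_pos' (fun j _ => sq_nonneg _) ⟨i, Finset.mem_univ i, by
    have : u i ≠ 0 := hi
    positivity⟩

lemma key_zero_le (w : Fin d → ℤ) : key (0 : Fin d → ℤ) ≤ key w := by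
  rcases eq_or_ne w 0 with rfl | hw
  · exact le_rfl
  · exact key_le_of_sum_lt (by simpa using sum_sq_pos hw)

/-- The points `v` that are closer to `0` than to every point of `-R`, ties being broken
by `key`. -/
def cell (R : Set (Fin d → ℤ)) : Set (Fin d → ℤ) :=
  {v | ∀ u ∈ R, key v ≤ key (v + u)}

lemma zero_mem_cell (R : Set (Fin d → ℤ)) : 0 ∈ cell R := fun _ _ => key_zero_le _

lemma almostConvex_cell (R : Set (Fin d → ℤ)) : AlmostConvex (cell R) := by
  intro v hv u hu
  rcases eq_or_ne u 0 with rfl | hu0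
  · simp
  apply key_le_of_sum_lt
  have hpos : (0 : ℝ) < ∑ i, (u i : ℝ) ^ 2 := by exact_mod_cast sum_sq_pos hu0
  have hconv : Convex ℝ {y : Fin d → ℝ | -∑ i, (u i : ℝ) ^ 2 ≤ ∑ i, 2 * y i * u i} := by
    refine convex_halfSpace_ge (f := fun y : Fin d → ℝ => ∑ i, 2 * y i * u i) ⟨?_, ?_⟩ _
    · intro x y
      simp only [Pi.add_apply, ← Finset.sum_add_distrib]
      exact Finset.sum_congr rfl fun i _ => by ring
    · intro c x
      simp only [Pi.smul_apply, smul_eq_mul, Finset.mul_sum]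
      exact Finset.sum_congr rfl fun i _ => by ring
  have hsub : convexHull ℝ ((fun (w : Fin d → ℤ) (i : Fin d) => (w i : ℝ)) '' cell R) ⊆
      {y : Fin d → ℝ | -∑ i, (u i : ℝ) ^ 2 ≤ ∑ i, 2 * y i * u i} := by
    refine convexHull_min ?_ hconv
    rintro _ ⟨w, hw, rfl⟩
    have h := sum_le_of_key_le (hw u hu)
    simp only [Pi.add_apply, add_sq, Finset.sum_add_distrib] at h
    have h' : -∑ i, u i ^ 2 ≤ ∑ i, 2 * w i * u i := by linarith
    simpa using (by exact_mod_cast h' :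
      -∑ i, (u i : ℝ) ^ 2 ≤ ∑ i, 2 * (w i : ℝ) * u i)
  have hcont : Continuous fun t : ℝ => fun i => (v i : ℝ) - t * u i := by fun_prop
  have hnhds : ∀ᶠ t in nhds (0 : ℝ), (fun i => (v i : ℝ) - t * u i) ∈
      convexHull ℝ ((fun (w : Fin d → ℤ) (i : Fin d) => (w i : ℝ)) '' cell R) :=
    hcont.continuousAt.eventually_mem (by simpa using mem_interior_iff_mem_nhds.1 hv)
  obtain ⟨t, ht, ht0⟩ :=
    ((hnhds.filter_mono (nhdsWithin_le_nhds (s := Set.Ioi 0))).and self_mem_nhdsWithin).exists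
  have h := hsub ht
  have ht0 : 0 < t := ht0
  have hexp : ∑ i, 2 * ((v i : ℝ) - t * u i) * u i =
      ∑ i, 2 * (v i : ℝ) * u i - 2 * t * ∑ i, (u i : ℝ) ^ 2 := by
    rw [Finset.mul_sum, ← Finset.sum_sub_distrib]
    exact Finset.sum_congr rfl fun i _ => by ring
  simp only [Set.mem_ofPred_eq, hexp] at h
  have hreal : -∑ i, (u i : ℝ) ^ 2 < ∑ i, 2 * (v i : ℝ) * u i := by
    nlinarith [mul_pos ht0 hpos]
  have hint : -∑ i, u i ^ 2 < ∑ i, 2 * v i * u i := by exact_mod_cast hreal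
  simp only [Pi.add_apply, add_sq, Finset.sum_add_distrib]
  linarith

lemma almostConvex_singleton_zero :
    AlmostConvex (({0} : Finset (Fin d → ℤ)) : Set (Fin d → ℤ)) := by
  intro v hv
  have h := interior_subset hv
  simp only [Finset.coe_singleton, Set.image_singleton, convexHull_singleton,
    Set.mem_singleton_iff] at h ⊢
  ext i
  simpa using congrFun h i

/-- A sequence listing all finite almost convex sets containing `0`. -/
lemma exists_enumeration (d : ℕ) : ∃ B : ℕ → Finset (Fin d → ℤ),
    (∀ n, AlmostConvex (B n : Set (Fin d → ℤ))) ∧ (∀ n, (0 : Fin d → ℤ) ∈ B n) ∧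
    ∀ s : Finset (Fin d → ℤ), AlmostConvex (s : Set (Fin d → ℤ)) → 0 ∈ s → ∃ n, B n = s := by
  let S := {s : Finset (Fin d → ℤ) // AlmostConvex (s : Set (Fin d → ℤ)) ∧ 0 ∈ s}
  have hS : Nonempty S := ⟨{0}, almostConvex_singleton_zero, by simp⟩
  obtain ⟨f, hf⟩ := exists_surjective_nat S
  refine ⟨fun n => (f n).1, fun n => (f n).2.1, fun n => (f n).2.2, fun s h1 h2 => ?_⟩
  obtain ⟨n, hn⟩ := hf ⟨s, h1, h2⟩
  exact ⟨n, congrArg Subtype.val hn⟩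

section Action

variable {X : Type*} (T : (Fin d → ℤ) → X → X) (A : Set X)

/-- `T v x` is the point of `A` nearest to `x` along its orbit, ties being broken by `key`. -/
def IsNearest (v : Fin d → ℤ) (x : X) : Prop :=
  T v x ∈ A ∧ ∀ w, T w x ∈ A → key v ≤ key w

variable {T A}

lemma IsNearest.eq {v w : Fin d → ℤ} {x : X} (hv : IsNearest T A v x) (hw : IsNearest T A w x) :
    v = w :=
  key_injective (le_antisymm (hv.2 w hw.1) (hw.2 v hv.1))

lemma exists_isNearest {v : Fin d → ℤ} {x : X} (h : T v x ∈ A) : ∃ w, IsNearest T A w x := by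
  obtain ⟨w, hw, hmin⟩ := (InvImage.wf (key (d := d)) wellFounded_lt).has_min
    {v | T v x ∈ A} ⟨v, h⟩
  exact ⟨w, hw, fun u hu => not_lt.1 (hmin u hu)⟩

lemma isNearest_iff (hT : ∀ v w : Fin d → ℤ, T v ∘ T w = T (v + w)) (v : Fin d → ℤ) (x : X) :
    IsNearest T A v x ↔ T v x ∈ A ∧ v ∈ cell {u | T u (T v x) ∈ A} := by
  have hT' : ∀ u w y, T u (T w y) = T (u + w) y := fun u w y => congrFun (hT u w) y
  refine and_congr_right fun _ => ⟨fun h u hu => h _ ?_, fun h w hw => ?_⟩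
  · simpa [hT', add_comm] using hu
  · simpa using h (w - v) (by simpa [hT'] using hw)

variable [MeasurableSpace X]

lemma measurableSet_mem_cell (hT : ∀ v, Measurable (T v)) (hA : MeasurableSet A)
    (v : Fin d → ℤ) : MeasurableSet {a | v ∈ cell {u | T u a ∈ A}} := by
  have : {a | v ∈ cell {u | T u a ∈ A}} =
      ⋂ u, {a | T u a ∈ A → key v ≤ key (v + u)} := by
    ext a; simp [cell]
  rw [this]
  refine MeasurableSet.iInter fun u => ?_
  by_cases h : key v ≤ key (v + u)
  · simp [h]
  · simpa only [h, imp_false] using! (hT u hA).compl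

lemma measurableSet_cell_eq (hT : ∀ v, Measurable (T v)) (hA : MeasurableSet A)
    (s : Set (Fin d → ℤ)) : MeasurableSet {a | s = cell {u | T u a ∈ A}} := by
  have : {a | s = cell {u | T u a ∈ A}} =
      ⋂ v, {a | v ∈ s ↔ v ∈ cell {u | T u a ∈ A}} := by
    ext a; simp [Set.ext_iff]
  rw [this]
  refine MeasurableSet.iInter fun v => ?_
  by_cases h : v ∈ s
  · simpa [h] using measurableSet_mem_cell hT hA v
  · simpa only [h, false_iff] using! (measurableSet_mem_cell hT hA v).compl

/-- Mass transport: the cells of the points of `A` have average size one. -/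
lemma lintegral_encard_cell {μ : Measure X} [IsProbabilityMeasure μ]
    (hT : ∀ v w : Fin d → ℤ, T v ∘ T w = T (v + w))
    (hμ : ∀ v, MeasurePreserving (T v) μ μ) (hA : MeasurableSet A)
    (hsweep : μ (⋃ v, T v ⁻¹' A) = 1) :
    ∫⁻ a in A, ∑' v, {a | v ∈ cell {u | T u a ∈ A}}.indicator 1 a ∂μ = 1 := by
  have hm := measurableSet_mem_cell (fun v => (hμ v).measurable) hA
  rw [lintegral_tsum fun v => (measurable_one.indicator (hm v)).aemeasurable]
  have hpre : ∀ v, T v ⁻¹' ({a | v ∈ cell {u | T u a ∈ A}} ∩ A) = {x | IsNearest T A v x} := by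
    intro v
    ext x
    simp only [Set.mem_preimage, Set.mem_inter_iff, Set.mem_ofPred_eq, isNearest_iff hT]
    exact and_comm
  have hterm : ∀ v, ∫⁻ a in A, {a | v ∈ cell {u | T u a ∈ A}}.indicator 1 a ∂μ =
      μ {x | IsNearest T A v x} := by
    intro v
    rw [lintegral_indicator_one (hm v), Measure.restrict_apply (hm v), ← hpre,
      (hμ v).measure_preimage ((hm v).inter hA).nullMeasurableSet]
  simp_rw [hterm]
  rw [← measure_iUnion]
  · rw [← hsweep]
    congr 1
    ext x
    simp only [Set.mem_iUnion, Set.mem_ofPred_eq, Set.mem_preimage]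
    exact ⟨fun ⟨v, hv⟩ => ⟨v, hv.1⟩, fun ⟨v, hv⟩ => exists_isNearest hv⟩
  · intro v w hvw
    exact Set.disjoint_left.2 fun x hv hw => hvw (IsNearest.eq hv hw)
  · intro v
    rw [← hpre]
    exact (hμ v).measurable ((hm v).inter hA)

end Action

end KacVoronoi

open KacVoronoi in
/-- **Kac's lemma for `ℤ^d` with almost-convex shapes.** There is a sequence of finite
almost convex subsets `B n ⊆ ℤ^d`, each containing `0`, such that for every
probability-preserving `ℤ^d`-action `(X, μ, T)` and every sweep-out set `A` there is a
measurable `φ : A → ℕ` such that the sets `T v ⁻¹' (A ∩ φ⁻¹ {n})`, for `n ∈ ℕ` and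
`v ∈ B n`, are pairwise disjoint, their union has full measure, and
`∫_A |B (φ x)| dμ = 1`. -/
theorem kac_Zd_almost_convex (d : ℕ) :
    ∃ B : ℕ → Finset (Fin d → ℤ),
      (∀ n, AlmostConvex (B n : Set (Fin d → ℤ))) ∧ (∀ n, (0 : Fin d → ℤ) ∈ B n) ∧
      ∀ (X : Type*) [MeasurableSpace X] (μ : Measure X) [IsProbabilityMeasure μ]
        (T : (Fin d → ℤ) → X → X), T 0 = id → (∀ v w : Fin d → ℤ, T v ∘ T w = T (v + w)) →
        (∀ v : Fin d → ℤ, MeasurePreserving (T v) μ μ) →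
        ∀ A : Set X, MeasurableSet A → μ (⋃ v : Fin d → ℤ, T v ⁻¹' A) = 1 →
        ∃ φ : X → ℕ, Measurable φ ∧
          (∀ (n m : ℕ) (v w : Fin d → ℤ), v ∈ B n → w ∈ B m → (n, v) ≠ (m, w) →
            Disjoint (T v ⁻¹' (A ∩ φ ⁻¹' {n})) (T w ⁻¹' (A ∩ φ ⁻¹' {m}))) ∧
          μ (⋃ n : ℕ, ⋃ v ∈ B n, T v ⁻¹' (A ∩ φ ⁻¹' {n})) = 1 ∧
          ∫⁻ x in A, ((B (φ x)).card : ENNReal) ∂μ = 1 := by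
  classical
  obtain ⟨B, hconv, hzero, hsurj⟩ := exists_enumeration d
  refine ⟨B, hconv, hzero, ?_⟩
  intro X _ μ _ T _ hT hμ A hA hsweep
  obtain ⟨n₀, hn₀⟩ : ∃ n, B n = {0} := hsurj {0} almostConvex_singleton_zero (by simp)
  let C : X → Set (Fin d → ℤ) := fun a => cell {u | T u a ∈ A}
  have hC : ∀ n, MeasurableSet {a | (B n : Set (Fin d → ℤ)) = C a} := fun n =>
    measurableSet_cell_eq (fun v => (hμ v).measurable) hA _
  let p : X → ℕ → Prop := fun a n =>
    (B n : Set (Fin d → ℤ)) = C a ∨ ((¬ ∃ m, (B m : Set (Fin d → ℤ)) = C a) ∧ n = n₀)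
  have hp : ∀ a, ∃ n, p a n := by
    intro a
    by_cases h : ∃ m, (B m : Set (Fin d → ℤ)) = C a
    · exact h.imp fun n hn => Or.inl hn
    · exact ⟨n₀, Or.inr ⟨h, rfl⟩⟩
  have hpm : ∀ n, MeasurableSet {a | p a n} := by
    intro n
    have hex : MeasurableSet {a | ∃ m, (B m : Set (Fin d → ℤ)) = C a} := by
      rw [Set.ofPred_exists]
      exact MeasurableSet.iUnion hC
    exact (hC n).union (hex.compl.inter (MeasurableSet.const _))
  let φ : X → ℕ := fun a => Nat.find (hp a)
  have hφ : Measurable φ := measurable_find hp hpm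
  have hsub : ∀ a, (B (φ a) : Set (Fin d → ℤ)) ⊆ C a := by
    intro a
    rcases Nat.find_spec (hp a) with h | ⟨_, h⟩
    · exact h.subset
    · have h' : φ a = n₀ := h
      rw [h', hn₀]
      simpa using zero_mem_cell _
  have heq : ∀ a, (C a).Finite → (B (φ a) : Set (Fin d → ℤ)) = C a := by
    intro a hfin
    have hex : ∃ m, (B m : Set (Fin d → ℤ)) = C a := by
      obtain ⟨m, hm⟩ := hsurj hfin.toFinset
        (by simpa using almostConvex_cell _) (by simpa using zero_mem_cell _)
      exact ⟨m, by simp [hm]⟩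
    rcases Nat.find_spec (hp a) with h | ⟨h, _⟩
    · exact h
    · exact absurd hex h
  have hint := lintegral_encard_cell hT hμ hA hsweep
  have hmeas : Measurable fun a => ∑' v, {a | v ∈ C a}.indicator (1 : X → ENNReal) a :=
    Measurable.tsum fun v => measurable_one.indicator
      (measurableSet_mem_cell (fun v => (hμ v).measurable) hA v)
  have hind : ∀ (a : X) (v : Fin d → ℤ), {a | v ∈ C a}.indicator (1 : X → ENNReal) a =
      (C a).indicator 1 v := fun _ _ => rfl
  have hfin : ∀ᵐ a ∂μ.restrict A, (C a).Finite := by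
    filter_upwards [ae_lt_top hmeas (by rw [hint]; exact ENNReal.one_ne_top)] with a ha
    simp_rw [hind] at ha
    refine (ENNReal.finite_const_le_of_tsum_ne_top ha.ne one_ne_zero).subset fun v hv => ?_
    simp [hv]
  refine ⟨φ, hφ, ?_, ?_, ?_⟩
  · intro n m v w hv hw hne
    refine Set.disjoint_left.2 ?_
    rintro x ⟨hvA, hn⟩ ⟨hwA, hm⟩
    have hn : φ (T v x) = n := hn
    have hm : φ (T w x) = m := hm
    have h₁ : IsNearest T A v x :=
      (isNearest_iff hT v x).2 ⟨hvA, hsub _ (by rw [hn]; exact hv)⟩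
    have h₂ : IsNearest T A w x :=
      (isNearest_iff hT w x).2 ⟨hwA, hsub _ (by rw [hm]; exact hw)⟩
    obtain rfl := h₁.eq h₂
    exact hne (by rw [← hn, ← hm])
  · have hfin' : ∀ᵐ x ∂μ, ∀ v, T v x ∈ A → (C (T v x)).Finite :=
      ae_all_iff.2 fun v => (hμ v).quasiMeasurePreserving.ae ((ae_restrict_iff' hA).1 hfin)
    rw [← hsweep]
    refine measure_congr ?_
    filter_upwards [hfin'] with x hx
    refine propext ⟨fun h => ?_, fun h => ?_⟩
    · obtain ⟨n, hn⟩ := Set.mem_iUnion.1 h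
      obtain ⟨v, -, hvA, -⟩ := Set.mem_iUnion₂.1 hn
      exact Set.mem_iUnion.2 ⟨v, hvA⟩
    · obtain ⟨v, hv⟩ := Set.mem_iUnion.1 h
      obtain ⟨w, hw⟩ := exists_isNearest hv
      obtain ⟨hwA, hwC⟩ := (isNearest_iff hT w x).1 hw
      refine Set.mem_iUnion.2 ⟨φ (T w x), Set.mem_iUnion₂.2 ⟨w, ?_, hwA, rfl⟩⟩
      exact Finset.mem_coe.1 (by rw [heq _ (hx w hwA)]; exact hwC)
  · rw [← hint]
    refine lintegral_congr_ae ?_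
    filter_upwards [hfin] with a ha
    change _ = ∑' v, {a | v ∈ C a}.indicator (1 : X → ENNReal) a
    simp_rw [hind, ← heq a ha]
    rw [← tsum_subtype]
    simp
end

section
/- Let (X, B, μ, T) be a probability-preserving action of a countable group Γ, let B_1, B_2, … be a sequence of (not necessarily finite) subsets of Γ, let A ∈ B, and let φ : A → ℕ be a measurable function such that the sets T_γ⁻¹(φ⁻¹({n})) for n ∈ ℕ, γ ∈ B_n are pairwise disjoint. Then for every n ∈ ℕ, μ({ x ∈ A : |B_{φ(x)}| ≥ n }) ≤ 1/n. In particular, if |B_n| = +∞ then μ(φ⁻¹({n})) = 0. -/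
open MeasureTheory

/-- If countably many measurable sets `C n` admit pairwise disjoint preimages `T γ ⁻¹' C n`,
`γ ∈ B n`, under measure-preserving maps of a probability space, then `∑ n, |B n| * μ (C n) ≤ 1`. -/
theorem tsum_encard_mul_measure_le_one {Γ X : Type*} [MeasurableSpace X] (μ : Measure X)
    [IsProbabilityMeasure μ] (T : Γ → X → X) (hT : ∀ γ : Γ, MeasurePreserving (T γ) μ μ)
    (B : ℕ → Set Γ) (C : ℕ → Set X) (hC : ∀ n, MeasurableSet (C n))
    (hdisj : ∀ (n m : ℕ) (γ γ' : Γ), γ ∈ B n → γ' ∈ B m → (n, γ) ≠ (m, γ') →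
      Disjoint (T γ ⁻¹' C n) (T γ' ⁻¹' C m)) :
    ∑' n, ((B n).encard : ENNReal) * μ (C n) ≤ 1 := by
  have h : ∑' p : Σ n, B n, μ (T p.2 ⁻¹' C p.1) ≤ μ Set.univ := by
    refine tsum_measure_le_measure_univ
      (fun p => ((hT p.2).measurable (hC p.1)).nullMeasurableSet) ?_
    rintro ⟨n, γ, hγ⟩ ⟨m, γ', hγ'⟩ hne
    refine (hdisj n m γ γ' hγ hγ' ?_).aedisjoint
    rintro heq
    obtain ⟨rfl, rfl⟩ := Prod.mk.inj heq
    exact hne rfl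
  rw [measure_univ, ENNReal.tsum_sigma'] at h
  refine le_trans (le_of_eq (tsum_congr fun n => ?_)) h
  simp_rw [fun γ : Γ => (hT γ).measure_preimage (hC n).nullMeasurableSet]
  rw [ENNReal.tsum_const, Set.encard]

/-- A variation of Poincaré recurrence: if `(X, μ, T)` is a probability-preserving action of a
countable group `Γ`, `B n ⊆ Γ` are subsets (not necessarily finite), `A` is measurable and
`φ : A → ℕ` is measurable such that the sets `T γ ⁻¹' (A ∩ φ⁻¹ {n})`, `n ∈ ℕ`, `γ ∈ B n`,
are pairwise disjoint, then `μ {x ∈ A : |B (φ x)| ≥ n} ≤ 1/n` for every `n`; in particular,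
if `B n` is infinite then `μ (A ∩ φ⁻¹ {n}) = 0`. -/
theorem kac_cell_size_markov {Γ X : Type*} [Group Γ] [Countable Γ]
    [MeasurableSpace X] (μ : Measure X) [IsProbabilityMeasure μ]
    (T : Γ → X → X) (hT1 : T 1 = id) (hTmul : ∀ γ δ : Γ, T γ ∘ T δ = T (γ * δ))
    (hTmp : ∀ γ : Γ, MeasurePreserving (T γ) μ μ)
    (B : ℕ → Set Γ) (A : Set X) (hA : MeasurableSet A)
    (φ : X → ℕ) (hφ : Measurable φ)
    (hdisj : ∀ (n m : ℕ) (γ γ' : Γ), γ ∈ B n → γ' ∈ B m → (n, γ) ≠ (m, γ') →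
      Disjoint (T γ ⁻¹' (A ∩ φ ⁻¹' {n})) (T γ' ⁻¹' (A ∩ φ ⁻¹' {m}))) :
    (∀ n : ℕ, μ {x | x ∈ A ∧ (n : ℕ∞) ≤ (B (φ x)).encard} ≤ 1 / (n : ENNReal)) ∧
      ∀ n : ℕ, (B n).Infinite → μ (A ∩ φ ⁻¹' {n}) = 0 := by
  have hC : ∀ n, MeasurableSet (A ∩ φ ⁻¹' {n}) := fun n =>
    hA.inter (hφ (measurableSet_singleton n))
  have hsum := tsum_encard_mul_measure_le_one μ T hTmp B (fun n => A ∩ φ ⁻¹' {n}) hC hdisj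
  refine ⟨fun n => ?_, fun n hn => ?_⟩
  · rw [ENNReal.le_div_iff_mul_le (Or.inr one_ne_zero) (Or.inl (ENNReal.natCast_ne_top n)),
      mul_comm]
    refine le_trans ?_ hsum
    have hsub : {x | x ∈ A ∧ (n : ℕ∞) ≤ (B (φ x)).encard} ⊆
        ⋃ m, {x | x ∈ A ∩ φ ⁻¹' {m} ∧ (n : ℕ∞) ≤ (B m).encard} :=
      fun x hx => Set.mem_iUnion.2 ⟨φ x, ⟨hx.1, rfl⟩, hx.2⟩
    calc (n : ENNReal) * μ {x | x ∈ A ∧ (n : ℕ∞) ≤ (B (φ x)).encard}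
        ≤ n * ∑' m, μ {x | x ∈ A ∩ φ ⁻¹' {m} ∧ (n : ℕ∞) ≤ (B m).encard} := by
          gcongr
          exact (measure_mono hsub).trans (measure_iUnion_le _)
      _ = ∑' m, n * μ {x | x ∈ A ∩ φ ⁻¹' {m} ∧ (n : ℕ∞) ≤ (B m).encard} :=
          ENNReal.tsum_mul_left.symm
      _ ≤ ∑' m, ((B m).encard : ENNReal) * μ (A ∩ φ ⁻¹' {m}) := by
          refine ENNReal.tsum_le_tsum fun m => ?_
          by_cases hm : (n : ℕ∞) ≤ (B m).encard
          · refine mul_le_mul' ?_ (measure_mono fun x hx => hx.1)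
            exact_mod_cast ENat.toENNReal_le.2 hm
          · simp [hm]
  · by_contra hne
    have hle := (ENNReal.le_tsum n).trans hsum
    rw [hn.encard_eq, ENat.toENNReal_top, ENNReal.top_mul hne] at hle
    exact absurd hle (by simp)
end

section
/- Let (X, B, μ, T) be a probability-preserving action of a countable group Γ, let A ∈ B, and let κ : X → Γ be an A-allocation. For x ∈ A define B_κ(x) = { γ ∈ Γ : κ(T_γ⁻¹(x)) = γ }. Then B_κ(x) is a finite set for μ-almost every x ∈ A; consequently, enumerating the finite subsets of Γ as B_1, B_2, …, the set A decomposes, up to a μ-null set, as the disjoint union over n ∈ ℕ of the sets { x ∈ A : B_κ(x) = B_n }. -/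
open MeasureTheory

/-- If each `T γ` preserves a finite measure and the fibres of `κ` are measurable, then for almost
every `x` there are only finitely many `γ` with `κ (T γ⁻¹ x) = γ`. -/
theorem ae_finite_setOf_allocation_eq {Γ X : Type*} [Group Γ] [Countable Γ]
    [MeasurableSpace X] (μ : Measure X) [IsFiniteMeasure μ] (T : Γ → X → X)
    (hT : ∀ γ : Γ, MeasurePreserving (T γ) μ μ) (κ : X → Γ)
    (hκ : ∀ γ : Γ, MeasurableSet {x | κ x = γ}) :
    ∀ᵐ x ∂μ, {γ : Γ | κ (T γ⁻¹ x) = γ}.Finite := by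
  refine ae_finite_setOfPred_mem (s := fun γ => T γ⁻¹ ⁻¹' {x | κ x = γ}) ?_
  have h_disj : Pairwise (Function.onFun Disjoint fun γ => {x | κ x = γ}) := fun γ δ hne =>
    Set.disjoint_left.2 fun x hx hx' => hne (hx.symm.trans hx')
  simp_rw [fun γ => (hT γ⁻¹).measure_preimage (hκ γ).nullMeasurableSet]
  rw [← measure_iUnion h_disj hκ]
  exact measure_ne_top μ _

/-- **Cells of an allocation are finite, and they partition `A`.** Let `(X, μ, T)` be a
probability-preserving action of a countable group `Γ`, `A` measurable, and `κ : X → Γ` an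
`A`-allocation. For `x ∈ A` let `B_κ x = {γ : Γ | κ (T γ⁻¹ x) = γ}`. Then `B_κ x` is finite
for almost every `x ∈ A`, and, up to a `μ`-null set, `A` is the disjoint (countable) union,
over the finite subsets `F` of `Γ`, of the sets `{x ∈ A | B_κ x = F}`. -/
theorem allocation_cells_partition {Γ X : Type*} [Group Γ] [Countable Γ]
    [MeasurableSpace X] (μ : Measure X) [IsProbabilityMeasure μ]
    (T : Γ → X → X) (hT1 : T 1 = id) (hTmul : ∀ γ δ : Γ, T γ ∘ T δ = T (γ * δ))
    (hTmp : ∀ γ : Γ, MeasurePreserving (T γ) μ μ)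
    (A : Set X) (hA : MeasurableSet A)
    (κ : X → Γ) (hκmeas : ∀ γ : Γ, MeasurableSet {x | κ x = γ})
    (hκalloc : ∀ᵐ x ∂μ, T (κ x) x ∈ A) :
    (∀ᵐ x ∂μ.restrict A, {γ : Γ | κ (T γ⁻¹ x) = γ}.Finite) ∧
      (∀ F F' : Finset Γ, F ≠ F' →
        Disjoint {x | x ∈ A ∧ {γ : Γ | κ (T γ⁻¹ x) = γ} = (F : Set Γ)}
          {x | x ∈ A ∧ {γ : Γ | κ (T γ⁻¹ x) = γ} = (F' : Set Γ)}) ∧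
      μ (A \ ⋃ F : Finset Γ, {x | x ∈ A ∧ {γ : Γ | κ (T γ⁻¹ x) = γ} = (F : Set Γ)}) = 0 := by
  have h_fin := ae_finite_setOf_allocation_eq μ T hTmp κ hκmeas
  refine ⟨ae_restrict_of_ae h_fin, fun F F' hne => ?_, ?_⟩
  · exact Set.disjoint_left.2 fun x hx hx' =>
      hne (Finset.coe_injective (hx.2.symm.trans hx'.2))
  · refine measure_mono_null (fun x hx => ?_) (ae_iff.1 h_fin)
    exact fun h => hx.2 (Set.mem_iUnion.2 ⟨h.toFinset, hx.1, h.coe_toFinset.symm⟩)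
end

section
/- Let (X, B, μ, T) be a probability-preserving action of a countable group Γ on a standard probability space, and assume that μ-almost every point of X has an infinite Γ-orbit. Then for every ε > 0 there exists a countable measurable partition of X (up to a μ-null set) into sweep-out sets, each of measure at most ε. -/
open MeasureTheory

lemma range_orbit_apply {Γ X : Type*} [Group Γ] {T : Γ → X → X}
    (hTmul : ∀ γ δ : Γ, T γ ∘ T δ = T (γ * δ)) (δ : Γ) (x : X) :
    (Set.range fun γ : Γ => T γ (T δ x)) = Set.range fun γ : Γ => T γ x := by
  have h : (fun γ : Γ => T γ (T δ x)) = (fun γ : Γ => T γ x) ∘ fun γ => γ * δ :=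
    funext fun γ => congrFun (hTmul γ δ) x
  rw [h, (mul_right_surjective δ).range_comp]

/-- An atom with an infinite orbit would produce infinitely many atoms of the same mass. -/
lemma nullSingletonClass_of_infinite_orbits {Γ X : Type*}
    [MeasurableSpace X] [MeasurableSingletonClass X] {μ : Measure X} [IsFiniteMeasure μ]
    {T : Γ → X → X} (hTmp : ∀ γ : Γ, MeasurePreserving (T γ) μ μ)
    (hinf : ∀ᵐ x ∂μ, (Set.range fun γ : Γ => T γ x).Infinite) : NullSingletonClass μ := by
  refine ⟨fun x => ?_⟩
  by_contra hx
  have hxinf : (Set.range fun γ : Γ => T γ x).Infinite := by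
    by_contra h
    exact hx (measure_mono_null (Set.singleton_subset_iff.2 h) hinf)
  have hmass : ∀ y ∈ Set.range fun γ : Γ => T γ x, μ {x} ≤ μ {y} := by
    rintro _ ⟨γ, rfl⟩
    rw [← (hTmp γ).measure_preimage (measurableSet_singleton (T γ x)).nullMeasurableSet]
    exact measure_mono (by simp)
  exact hxinf.meas_eq_top ⟨μ {x}, hx, hmass⟩ |> measure_ne_top μ _

/-- An atomless finite measure on a standard Borel space admits countable partitions into
arbitrarily small measurable pieces. -/
lemma exists_partition_measure_le {X : Type*} [MeasurableSpace X] [StandardBorelSpace X]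
    (μ : Measure X) [IsFiniteMeasure μ] [NullSingletonClass μ] {η : ENNReal} (hη : 0 < η) :
    ∃ D : ℕ → Set X, (∀ n, MeasurableSet (D n)) ∧ (Pairwise fun n m => Disjoint (D n) (D m)) ∧
      (⋃ n, D n) = Set.univ ∧ ∀ n, μ (D n) ≤ η := by
  let := upgradeStandardBorel X
  have h : ∀ x : X, ∃ U : Set X, x ∈ U ∧ IsOpen U ∧ μ U < η := fun x => by
    obtain ⟨U, hxU, hU, hμ⟩ := Set.exists_isOpen_lt_of_lt (μ := μ) {x} η (by simpa using hη)
    exact ⟨U, hxU rfl, hU, hμ⟩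
  choose U hxU hU hμU using h
  obtain ⟨s, hs, hcover⟩ :=
    TopologicalSpace.countable_cover_nhds fun x => (hU x).mem_nhds (hxU x)
  rcases s.eq_empty_or_nonempty with rfl | hne
  · refine ⟨fun _ => ∅, by simp, fun _ _ _ => by simp, ?_, by simp⟩
    simpa using hcover
  obtain ⟨e, rfl⟩ := hs.exists_eq_range hne
  refine ⟨disjointed fun n => U (e n), fun n => .disjointed (fun k => (hU _).measurableSet) n,
    disjoint_disjointed _, ?_,
    fun n => (measure_mono (disjointed_subset _ n)).trans (hμU _).le⟩
  rw [iUnion_disjointed]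
  simpa using hcover

lemma measurableSet_setOf_infinite_orbit_inter {Γ X Y : Type*} [Countable Γ]
    [MeasurableSpace X] [MeasurableSpace Y] [MeasurableEq Y]
    {T : Γ → X → Y} (hT : ∀ γ, Measurable (T γ)) {S : Set Y} (hS : MeasurableSet S) :
    MeasurableSet {x | ((Set.range fun γ => T γ x) ∩ S).Infinite} := by
  have h : {x | ((Set.range fun γ => T γ x) ∩ S).Infinite} =
      ⋂ F : Finset Γ, ⋃ γ, T γ ⁻¹' S ∩ ⋂ δ ∈ F, {x | T γ x = T δ x}ᶜ := by
    classical
    ext x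
    simp only [Set.mem_ofPred_eq, Set.mem_iInter, Set.mem_iUnion, Set.mem_inter_iff,
      Set.mem_preimage, Set.mem_compl_iff]
    constructor
    · intro hx F
      obtain ⟨_, ⟨⟨γ, rfl⟩, hγS⟩, hγF⟩ := hx.exists_notMem_finset (F.image fun δ => T δ x)
      exact ⟨γ, hγS, fun δ hδ h => hγF (Finset.mem_image.2 ⟨δ, hδ, h.symm⟩)⟩
    · intro hx hfin
      have : Nonempty Γ := (hx ∅).nonempty
      have hrep : ∀ y ∈ (Set.range fun γ => T γ x) ∩ S, ∃ γ, T γ x = y := fun y hy => hy.1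
      choose! e he using hrep
      obtain ⟨γ, hγS, hγ⟩ := hx (hfin.toFinset.image e)
      have hmem : T γ x ∈ (Set.range fun γ => T γ x) ∩ S := ⟨⟨γ, rfl⟩, hγS⟩
      exact hγ _ (Finset.mem_image_of_mem e (hfin.mem_toFinset.2 hmem)) (he _ hmem).symm
  rw [h]
  refine .iInter fun F => .iUnion fun γ => (hT γ hS).inter (.biInter F.countable_toSet ?_)
  exact fun δ _ => (measurableSet_eq_fun (hT γ) (hT δ)).compl

/-- A measurable function to `ℕ` taking infinitely many values on each infinite orbit: it
measures the proximity of a point to the least accumulation point of its orbit. -/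
lemma exists_measurable_nat_infinite_on_orbits {Γ X : Type*} [Group Γ] [Countable Γ]
    [MeasurableSpace X] [StandardBorelSpace X] {T : Γ → X → X}
    (hTmul : ∀ γ δ : Γ, T γ ∘ T δ = T (γ * δ)) (hT : ∀ γ, Measurable (T γ)) :
    ∃ f : X → ℕ, Measurable f ∧ ∀ x, (Set.range fun γ : Γ => T γ x).Infinite →
      (Set.range fun γ : Γ => f (T γ x)).Infinite := by
  classical
  obtain ⟨φ, hφ, hφinj, hφlow, hφup⟩ : ∃ φ : X → ℝ, Measurable φ ∧ Function.Injective φ ∧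
      (∀ x, -2 < φ x) ∧ ∀ x, φ x < 2 := by
    refine ⟨fun x => Real.arctan (embeddingReal X x),
      Real.measurable_arctan.comp (measurableEmbedding_embeddingReal X).measurable,
      Real.arctan_injective.comp (measurableEmbedding_embeddingReal X).injective,
      fun x => ?_, fun x => ?_⟩
    · linarith [Real.neg_pi_div_two_lt_arctan (embeddingReal X x), Real.pi_lt_four]
    · linarith [Real.arctan_lt_pi_div_two (embeddingReal X x), Real.pi_lt_four]
  let O : X → Set X := fun x => Set.range fun γ : Γ => T γ x
  let low : ℚ → Set X := fun q => {y | φ y < q}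
  let g : Set X → ℚ → ℝ := fun A q => if (A ∩ low q).Infinite then q else 2
  let p : Set X → ℝ := fun A => ⨅ q, g A q
  have hp : Measurable fun x => p (O x) := by
    refine .iInf fun q => Measurable.ite ?_ measurable_const measurable_const
    exact measurableSet_setOf_infinite_orbit_inter hT (measurableSet_lt hφ measurable_const)
  have hbdd : ∀ A, BddBelow (Set.range (g A)) := by
    refine fun A => ⟨-2, ?_⟩
    rintro _ ⟨q, rfl⟩
    by_cases h : (A ∩ low q).Infinite
    · obtain ⟨y, -, hy⟩ := h.nonempty
      simpa only [g, if_pos h] using ((hφlow y).trans hy).le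
    · norm_num [g, if_neg h]
  have hclose : ∀ A : Set X, A.Infinite → ∀ δ > 0, (A ∩ {y | |φ y - p A| < δ}).Infinite := by
    intro A hA δ hδ
    obtain ⟨q, hq⟩ := exists_lt_of_ciInf_lt (lt_add_of_pos_right (p A) hδ)
    have hup : (A ∩ {y | φ y < p A + δ}).Infinite := by
      by_cases h : (A ∩ low q).Infinite
      · simp only [g, if_pos h] at hq
        exact h.mono fun y hy => ⟨hy.1, lt_trans hy.2 hq⟩
      · simp only [g, if_neg h] at hq
        exact hA.mono fun y hy => ⟨hy, (hφup y).trans hq⟩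
    obtain ⟨q', hq1, hq2⟩ := exists_rat_btwn (sub_lt_self (p A) hδ)
    have hfin : (A ∩ low q').Finite := by
      by_contra h
      have h3 := ciInf_le (hbdd A) q'
      have h4 : g A q' = q' := if_pos h
      exact absurd (h3.trans_eq h4) (not_le.2 hq2)
    refine (hup.sdiff hfin).mono fun y hy => ⟨hy.1.1, ?_⟩
    have h1 : φ y < p A + δ := hy.1.2
    have h2 : (q' : ℝ) ≤ φ y := not_lt.1 fun h => hy.2 ⟨hy.1.1, h⟩
    have h3 : |φ y - p A| < δ := abs_lt.2 ⟨by linarith, by linarith⟩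
    exact h3
  refine ⟨fun x => ⌊|φ x - p (O x)|⁻¹⌋₊,
    Nat.measurable_floor.comp ((hφ.sub hp).abs.inv), fun x hx => ?_⟩
  refine Set.infinite_of_not_bddAbove ?_
  rintro ⟨N, hN⟩
  obtain ⟨_, ⟨⟨⟨γ, rfl⟩, hlt⟩, hne⟩⟩ :=
    ((hclose (O x) hx ((N : ℝ) + 1)⁻¹ (by positivity)).sdiff
      ((Set.subsingleton_singleton (a := p (O x))).preimage hφinj).finite).nonempty
  have hle := hN ⟨γ, rfl⟩
  have hO : O (T γ x) = O x := range_orbit_apply hTmul γ x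
  simp only [hO] at hle
  have hpos : 0 < |φ (T γ x) - p (O x)| := abs_pos.2 (sub_ne_zero.2 hne)
  have hlt' := (lt_inv_comm₀ hpos (by positivity)).1 hlt
  have := Nat.le_floor (n := N + 1) (by exact_mod_cast hlt'.le)
  omega

/-- A measurable function to `ℕ` taking every value on each infinite orbit. -/
lemma exists_measurable_nat_surjective_on_orbits {Γ X : Type*} [Group Γ] [Countable Γ]
    [MeasurableSpace X] [StandardBorelSpace X] {T : Γ → X → X}
    (hTmul : ∀ γ δ : Γ, T γ ∘ T δ = T (γ * δ)) (hT : ∀ γ, Measurable (T γ)) :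
    ∃ r : X → ℕ, Measurable r ∧ ∀ x, (Set.range fun γ : Γ => T γ x).Infinite →
      Function.Surjective fun γ : Γ => r (T γ x) := by
  classical
  obtain ⟨f, hf, hfinf⟩ := exists_measurable_nat_infinite_on_orbits hTmul hT
  let L : X → Set ℕ := fun x => Set.range fun γ : Γ => f (T γ x)
  have hL : ∀ γ x, L (T γ x) = L x := fun γ x => by
    have h : ∀ y, L y = f '' Set.range fun γ : Γ => T γ y := fun y => by
      simp only [L, ← Set.range_comp, Function.comp_def]
    rw [h, h, range_orbit_apply hTmul]
  have hLmeas : ∀ m, MeasurableSet {x | m ∈ L x} := fun m => by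
    have h : {x | m ∈ L x} = ⋃ γ, (f ∘ T γ) ⁻¹' {m} := by
      ext x; simp [L]
    rw [h]
    exact .iUnion fun γ => (hf.comp (hT γ)) (measurableSet_singleton m)
  have hcount : ∀ n, Measurable fun x => Nat.count (· ∈ L x) n := fun n => by
    simp only [Nat.count_eq_card_filter_range, Finset.card_filter]
    exact Finset.measurable_sum _ fun m _ =>
      Measurable.ite (hLmeas m) measurable_const measurable_const
  refine ⟨fun x => Nat.count (· ∈ L x) (f x), ?_, fun x hx k => ?_⟩
  · have h : Measurable fun z : X × ℕ => Nat.count (· ∈ L z.1) z.2 :=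
      measurable_from_prod_countable_left hcount
    exact h.comp (measurable_id.prodMk hf)
  · have hinf : (Set.ofPred (· ∈ L x)).Infinite := hfinf x hx
    obtain ⟨γ, hγ⟩ := Nat.nth_mem_of_infinite hinf k
    refine ⟨γ, ?_⟩
    simp only [hL]
    exact (congrArg _ hγ).trans (Nat.count_nth_of_infinite hinf k)

/-- **Partition into small sweep-out sets.** Let `(X, μ, T)` be a probability-preserving
action of a countable group `Γ` on a standard probability space such that almost every point
has an infinite orbit. Then for every `ε > 0` there is a countable measurable partition of
`X` (up to a null set) into sweep-out sets, each of measure at most `ε`. -/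
theorem exists_partition_into_sweep_out_sets {Γ X : Type*} [Group Γ] [Countable Γ]
    [MeasurableSpace X] [StandardBorelSpace X]
    (μ : Measure X) [IsProbabilityMeasure μ]
    (T : Γ → X → X) (hT1 : T 1 = id) (hTmul : ∀ γ δ : Γ, T γ ∘ T δ = T (γ * δ))
    (hTmp : ∀ γ : Γ, MeasurePreserving (T γ) μ μ)
    (hinf : ∀ᵐ x ∂μ, (Set.range fun γ : Γ => T γ x).Infinite)
    (ε : ENNReal) (hε : 0 < ε) :
    ∃ P : ℕ → Set X,
      (∀ n, MeasurableSet (P n)) ∧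
      (Pairwise fun n m => Disjoint (P n) (P m)) ∧
      μ (⋃ n, P n) = 1 ∧
      (∀ n, μ (P n) ≤ ε) ∧
      (∀ n, μ (⋃ γ : Γ, T γ ⁻¹' (P n)) = 1) := by
  have := nullSingletonClass_of_infinite_orbits hTmp hinf
  have hη : 0 < ε / 2 := ENNReal.half_pos hε.ne'
  obtain ⟨D, hDm, hDd, hDu, hDμ⟩ := exists_partition_measure_le μ hη
  obtain ⟨r, hr, hrsurj⟩ :=
    exists_measurable_nat_surjective_on_orbits hTmul fun γ => (hTmp γ).measurable
  have hfib : ∀ k, MeasurableSet (r ⁻¹' {k}) := fun k => hr (measurableSet_singleton k)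
  have hsum : ∑' k, μ (r ⁻¹' {k}) ≠ ⊤ := by
    rw [← measure_iUnion (fun i j hij => Disjoint.preimage r (by simpa using hij)) hfib]
    exact measure_ne_top _ _
  obtain ⟨K, hK⟩ := Filter.eventually_atTop.1
    ((ENNReal.tendsto_atTop_zero_of_tsum_ne_top hsum).eventually_lt_const hη)
  refine ⟨fun j => r ⁻¹' {K + j} ∪ (D j ∩ r ⁻¹' Set.Iio K),
    fun j => (hfib _).union ((hDm j).inter (hr measurableSet_Iio)), fun i j hij => ?_, ?_,
    fun j => ?_, fun j => ?_⟩
  · refine Set.disjoint_left.2 fun x hi hj => ?_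
    rcases hi with hi | ⟨hi, hi'⟩ <;> rcases hj with hj | ⟨hj, hj'⟩ <;>
      simp only [Set.mem_preimage, Set.mem_singleton_iff, Set.mem_Iio] at *
    · omega
    · omega
    · omega
    · exact Set.disjoint_left.1 (hDd hij) hi hj
  · refine (congrArg μ (Set.eq_univ_of_forall fun x => Set.mem_iUnion.2 ?_)).trans measure_univ
    rcases lt_or_ge (r x) K with h | h
    · obtain ⟨j, hj⟩ := Set.mem_iUnion.1 (hDu ▸ Set.mem_univ x)
      exact ⟨j, .inr ⟨hj, h⟩⟩
    · exact ⟨r x - K, .inl (by simp; omega)⟩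
  · calc _ ≤ μ (r ⁻¹' {K + j}) + μ (D j ∩ r ⁻¹' Set.Iio K) := measure_union_le _ _
      _ ≤ ε / 2 + ε / 2 := add_le_add (hK _ (by omega)).le
          ((measure_mono Set.inter_subset_left).trans (hDμ j))
      _ = ε := ENNReal.add_halves ε
  · rw [← measure_univ (μ := μ)]
    refine measure_congr (Filter.eventuallyEq_univ.2 ?_)
    filter_upwards [hinf] with x hx
    obtain ⟨γ, hγ⟩ := hrsurj x hx (K + j)
    exact Set.mem_iUnion.2 ⟨γ, .inl hγ⟩
end
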